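/- arXiv:1006.0382 — 2 statements merged into one kernel-verified Lean document; each statement's English description precedes it below -/
import Mathlib

section
/- Let a : ℕ → ℚ_p satisfy ‖a_i · i!‖ → 0 as i → ∞, and let G : ℤ_p → ℚ_p be the Mahler series G(x) = Σ_{i≥0} a_i (−1)^i ∏_{j<i}(x−j). Then for every x ∈ ℤ_p, Σ_{i≥0} (i+1) a_{i+1} (−1)^i ∏_{j<i}(x−j) = −(G(x+1) − G(x)), both series being summable. (This is the identity [∂g] = −∇[g]: the Mahler transform of the derivative of the power series g = Σ a_i x^i equals minus the forward difference of the Mahler transform of g.) -/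
open Filter Finset

theorem padic_norm_prod_range_sub_le {p : ℕ} [Fact p.Prime] {x : ℚ_[p]} (hx : ‖x‖ ≤ 1) (n : ℕ) :
    ‖∏ j ∈ range n, (x - (j : ℚ_[p]))‖ ≤ ‖(n.factorial : ℚ_[p])‖ := by
  let y : ℤ_[p] := ⟨x, hx⟩
  have h := PadicInt.norm_ascPochhammer_le n (y - (n : ℤ_[p]) + 1)
  rw [← descPochhammer_eval_eq_ascPochhammer, descPochhammer_eval_eq_prod_range,
    PadicInt.norm_def, PadicInt.norm_def] at h
  have hy : ((∏ j ∈ range n, (y - (j : ℤ_[p])) : ℤ_[p]) : ℚ_[p]) =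
      ∏ j ∈ range n, (x - (j : ℚ_[p])) :=
    (map_prod PadicInt.Coe.ringHom _ _).trans (prod_congr rfl fun j _ =>
      (PadicInt.coe_sub y j).trans (by rw [PadicInt.coe_natCast]))
  rwa [hy, PadicInt.coe_natCast] at h

theorem summable_falling_factorial_series {p : ℕ} [Fact p.Prime] {a : ℕ → ℚ_[p]}
    (ha : Tendsto (fun i : ℕ => ‖a i * (Nat.factorial i : ℚ_[p])‖) atTop (nhds 0))
    {x : ℚ_[p]} (hx : ‖x‖ ≤ 1) :
    Summable (fun i : ℕ => a i * (-1) ^ i * ∏ j ∈ range i, (x - (j : ℚ_[p]))) := by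
  apply NonarchimedeanAddGroup.summable_of_tendsto_cofinite_zero
  rw [Nat.cofinite_eq_atTop]
  refine squeeze_zero_norm (fun i => ?_) ha
  simp only [norm_mul, norm_pow, norm_neg, norm_one, one_pow, mul_one]
  exact mul_le_mul_of_nonneg_left (padic_norm_prod_range_sub_le hx i) (norm_nonneg _)

theorem prod_range_add_one_sub_sub {R : Type*} [CommRing R] (x : R) (n : ℕ) :
    ∏ j ∈ range (n + 1), ((x + 1) - (j : R)) - ∏ j ∈ range (n + 1), (x - (j : R)) =
      ((n : R) + 1) * ∏ j ∈ range n, (x - (j : R)) := by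
  rw [prod_range_succ', prod_range_succ]
  simp only [Nat.cast_add, Nat.cast_one, Nat.cast_zero, add_sub_add_right_eq_sub]
  ring


/-- For `a : ℕ → ℚ_p` with `‖a_i · i!‖ → 0`, with Mahler series
`G(x) = Σ a_i (−1)^i (x)_i` on `ℤ_p` (the closed unit ball of `ℚ_p`), the Mahler
transform of the derivative satisfies `[∂g] = −∇[g]`, all series being summable. -/
theorem mahler_transform_deriv (p : ℕ) [Fact p.Prime] (a : ℕ → ℚ_[p])
    (ha : Tendsto (fun i : ℕ => ‖a i * (Nat.factorial i : ℚ_[p])‖) atTop (nhds 0))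
    (G : ℚ_[p] → ℚ_[p])
    (hG : ∀ y : ℚ_[p], ‖y‖ ≤ 1 →
      G y = ∑' i : ℕ, a i * (-1) ^ i * ∏ j ∈ range i, (y - (j : ℚ_[p])))
    (x : ℚ_[p]) (hx : ‖x‖ ≤ 1) :
    Summable (fun i : ℕ => a i * (-1) ^ i * ∏ j ∈ range i, (x - (j : ℚ_[p]))) ∧
    Summable (fun i : ℕ => a i * (-1) ^ i * ∏ j ∈ range i, ((x + 1) - (j : ℚ_[p]))) ∧
    Summable (fun i : ℕ =>
      ((i : ℚ_[p]) + 1) * a (i + 1) * (-1) ^ i * ∏ j ∈ range i, (x - (j : ℚ_[p]))) ∧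
    ∑' i : ℕ, ((i : ℚ_[p]) + 1) * a (i + 1) * (-1) ^ i * ∏ j ∈ range i, (x - (j : ℚ_[p])) =
      -(G (x + 1) - G x) := by
  have hx1 : ‖x + 1‖ ≤ 1 :=
    (IsUltrametricDist.norm_add_le_max x 1).trans (max_le hx norm_one.le)
  have h0 := summable_falling_factorial_series ha hx
  have h1 := summable_falling_factorial_series ha hx1
  have hterm (i : ℕ) :
      ((i : ℚ_[p]) + 1) * a (i + 1) * (-1) ^ i * ∏ j ∈ range i, (x - (j : ℚ_[p])) =
        -(a (i + 1) * (-1) ^ (i + 1) * ∏ j ∈ range (i + 1), ((x + 1) - (j : ℚ_[p])) -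
          a (i + 1) * (-1) ^ (i + 1) * ∏ j ∈ range (i + 1), (x - (j : ℚ_[p]))) := by
    rw [← mul_sub, prod_range_add_one_sub_sub]
    ring
  have hs := (h1.sub h0).neg
  refine ⟨h0, h1, ?_, ?_⟩
  · exact ((summable_nat_add_iff 1).2 hs).congr fun i => (hterm i).symm
  · rw [hG x hx, hG (x + 1) hx1, ← h1.tsum_sub h0, ← tsum_neg, hs.tsum_eq_zero_add]
    simp [hterm]
end

section
/- For all s, k : ℕ, the constant coefficient of T^s applied to x^k satisfies (T^s(x^k))(0) = (−1)^{s+k} · (coefficient of x^s in the polynomial (x)_k = x(x−1)⋯(x−k+1)), i.e. (T^s(x^k))(0) = ((−1)^{s+k}/s!) · (d^s/dx^s (x)_k)(0). (In the paper's notation: ⌊𝒟_x^s x^k⌋_0 = ((−1)^{s+k}/s!)(x)_k^{(s)}(0).) -/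
open Polynomial

/-- The operator `𝒟q = Σ_{i≥0} q^{(i)}` (a finite sum on polynomials, since
`q^{(i)} = 0` for `i > deg q`). -/
noncomputable def Dcal (q : Polynomial ℚ) : Polynomial ℚ :=
  ∑ i ∈ Finset.range (q.natDegree + 1), derivative^[i] q

/-- The operator `T q = 𝒟(q.divX)`, where `q.divX = (q − q(0))/x`; on monomials this
computes the paper's `⌊𝒟_x^s x^k⌋_0` as `(T^s(x^k))(0)`. -/
noncomputable def Tcal (q : Polynomial ℚ) : Polynomial ℚ :=
  Dcal q.divX

theorem Dcal_eq_sum_range {q : ℚ[X]} {N : ℕ} (h : q.natDegree < N) :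
    Dcal q = ∑ i ∈ Finset.range N, derivative^[i] q := by
  refine Finset.sum_subset (Finset.range_mono h) fun i _ hi => ?_
  exact iterate_derivative_eq_zero (by simpa using hi)

theorem Dcal_add (p q : ℚ[X]) : Dcal (p + q) = Dcal p + Dcal q := by
  have h := natDegree_add_le p q
  rw [Dcal_eq_sum_range (N := max p.natDegree q.natDegree + 1) (by omega),
    Dcal_eq_sum_range (q := p) (N := max p.natDegree q.natDegree + 1) (by omega),
    Dcal_eq_sum_range (q := q) (N := max p.natDegree q.natDegree + 1) (by omega),
    ← Finset.sum_add_distrib]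
  exact Finset.sum_congr rfl fun i _ => iterate_map_add derivative i p q

theorem Dcal_C_mul (a : ℚ) (q : ℚ[X]) : Dcal (C a * q) = C a * Dcal q := by
  have h := natDegree_C_mul_le a q
  rw [Dcal_eq_sum_range (N := q.natDegree + 1) (by omega), Dcal, Finset.mul_sum]
  exact Finset.sum_congr rfl fun i _ => iterate_derivative_C_mul a q i

/-- `𝒟` is the inverse of `1 - d/dx`. -/
theorem Dcal_eq_add_Dcal_derivative (q : ℚ[X]) : Dcal q = q + Dcal (derivative q) := by
  have h := natDegree_derivative_le q
  rw [Dcal_eq_sum_range (q := q) (N := q.natDegree + 1 + 1) (by omega), Finset.sum_range_succ',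
    Dcal_eq_sum_range (q := derivative q) (N := q.natDegree + 1) (by omega), add_comm]
  rfl

/-- `T` as a linear map. -/
noncomputable def TcalLinearMap : ℚ[X] →ₗ[ℚ] ℚ[X] where
  toFun := Tcal
  map_add' p q := by simp only [Tcal, divX_add, Dcal_add]
  map_smul' a q := by
    simp only [Tcal, smul_eq_C_mul, divX_C_mul, Dcal_C_mul, RingHom.id_apply]

theorem Tcal_iterate_eq_pow (s : ℕ) : Tcal^[s] = ⇑(TcalLinearMap ^ s) :=
  (Module.End.coe_pow TcalLinearMap s).symm

theorem Tcal_one : Tcal 1 = 0 := by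
  simp [Tcal, Dcal]

theorem Tcal_X_pow_succ (k : ℕ) :
    Tcal (X ^ (k + 1)) = X ^ k + (k : ℚ) • Tcal (X ^ k) := by
  have hdiv (n : ℕ) : (X ^ (n + 1) : ℚ[X]).divX = X ^ n := by simp [divX_X_pow]
  rw [Tcal, hdiv, Dcal_eq_add_Dcal_derivative]
  cases k with
  | zero => simp [Dcal]
  | succ k => rw [Tcal, hdiv, derivative_X_pow, Dcal_C_mul, smul_eq_C_mul, Nat.add_sub_cancel]

theorem Tcal_iterate_succ_X_pow_succ (s k : ℕ) :
    Tcal^[s + 1] (X ^ (k + 1)) = Tcal^[s] (X ^ k) + (k : ℚ) • Tcal^[s + 1] (X ^ k) := by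
  simp only [Function.iterate_succ_apply, Tcal_X_pow_succ, Tcal_iterate_eq_pow, map_add, map_smul]

theorem eval_zero_Tcal_iterate_X_pow (s k : ℕ) :
    (Tcal^[s] (X ^ k)).eval 0 = (-1) ^ (s + k) * (descPochhammer ℚ k).coeff s := by
  induction k generalizing s with
  | zero =>
    cases s with
    | zero => simp
    | succ s =>
      rw [pow_zero, Function.iterate_succ_apply, Tcal_one, Tcal_iterate_eq_pow, map_zero]
      simp [coeff_one]
  | succ k ih =>
    cases s with
    | zero => simp [coeff_zero_eq_eval_zero, descPochhammer_ne_zero_eval_zero]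
    | succ s =>
      rw [Tcal_iterate_succ_X_pow_succ, eval_add, eval_smul, ih, ih, descPochhammer_succ_right,
        mul_sub, coeff_sub, coeff_mul_X, coeff_mul_natCast, smul_eq_mul]
      ring

/-- `⌊𝒟_x^s x^k⌋_0 = ((−1)^{s+k}/s!)·(x)_k^{(s)}(0)`, where
`(x)_k = x(x−1)⋯(x−k+1)` is the falling factorial polynomial. -/
theorem constant_term_D_pow_monomial (s k : ℕ) :
    (Tcal^[s] (X ^ k)).eval 0 =
      ((-1) ^ (s + k) / (Nat.factorial s : ℚ)) *
        (derivative^[s] (descPochhammer ℚ k)).eval 0 := by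
  have h : (derivative^[s] (descPochhammer ℚ k)).eval 0 =
      (Nat.factorial s : ℚ) * (descPochhammer ℚ k).coeff s := by
    rw [← coeff_zero_eq_eval_zero, coeff_iterate_derivative, zero_add, Nat.descFactorial_self,
      nsmul_eq_mul]
  have hs : (Nat.factorial s : ℚ) ≠ 0 := mod_cast s.factorial_ne_zero
  rw [eval_zero_Tcal_iterate_X_pow, h]
  field_simp
end
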